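/- If g ≥ 12, then every element of R of level g − 5 lies in I; that is, 𝓡^i_{(g−5)} = 0 for all i. -/

import Mathlib

/- We model `R = ℚ[x₁, x₂, …]` as `MvPolynomial ℕ ℚ`, the variable of index `v`
representing `x_{v+1}` (so `x_k = X (k-1)` for `k ≥ 1`). -/

open MvPolynomial

noncomputable section

/-- Codimension grading: `codim x_{v+1} = v + 1`. -/
def codimW (d : ℕ →₀ ℕ) : ℕ := d.sum fun v e => (v + 1) * e

/-- Level grading: `ℓ(x_{v+1}) = v`. -/
def levelW (d : ℕ →₀ ℕ) : ℕ := d.sum fun v e => v * e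

/-- `R^i_{(j)}`: the ℚ-span of the monomials of codimension `i` and level `j`. -/
def Rij (i j : ℕ) : Submodule ℚ (MvPolynomial ℕ ℚ) :=
  Submodule.span ℚ
    { p | ∃ d : ℕ →₀ ℕ, codimW d = i ∧ levelW d = j ∧ p = monomial d (1 : ℚ) }

/-- Polishchuk's operator
`𝒟 = -g ∂₁ + (1/2) ∑_{m,n ≥ 1} binom(m+n, n) x_{m+n-1} ∂_m ∂_n`; in our indexing,
with `a = m−1`, `b = n−1`, the second term is
`(1/2) ∑_{a,b ≥ 0} binom(a+b+2, b+1) X(a+b) ∂_{X a} ∂_{X b}`.  On a given polynomial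
`p` only the finitely many terms with both variables occurring in `p` are nonzero, so
the sum may be cut off beyond all variable indices of `p`. -/
def Dop (g : ℕ) (p : MvPolynomial ℕ ℚ) : MvPolynomial ℕ ℚ :=
  -(g : ℚ) • pderiv 0 p +
    (1/2 : ℚ) •
      ∑ a ∈ Finset.range (p.vars.sup id + 1), ∑ b ∈ Finset.range (p.vars.sup id + 1),
        (((a + b + 2).choose (b + 1) : ℚ)) • (X (a + b) * pderiv a (pderiv b p))

/-- `R^{>g}`: span of monomials of codimension `> g`. -/
def Rgt (g : ℕ) : Submodule ℚ (MvPolynomial ℕ ℚ) :=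
  Submodule.span ℚ { p | ∃ d : ℕ →₀ ℕ, g < codimW d ∧ p = monomial d (1 : ℚ) }

/-- `Fil¹R^g`: span of monomials of codimension `g` and level `≥ 1`. -/
def Fil1Rg (g : ℕ) : Submodule ℚ (MvPolynomial ℕ ℚ) :=
  Submodule.span ℚ
    { p | ∃ d : ℕ →₀ ℕ, codimW d = g ∧ 1 ≤ levelW d ∧ p = monomial d (1 : ℚ) }

/-- Polishchuk's ideal of universal relations `I = R^{>g} + ∑_{n ≥ 0} 𝒟ⁿ(Fil¹R^g)`. -/
def Ipol (g : ℕ) : Submodule ℚ (MvPolynomial ℕ ℚ) :=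
  Rgt g ⊔ ⨆ n : ℕ, Submodule.span ℚ ((Dop g)^[n] '' (Fil1Rg g : Set (MvPolynomial ℕ ℚ)))

/-- Solving the linear relations which twofold merging of four parts, one of them equal to one,
imposes on a symmetric function of a part of `s`. -/
theorem eq_zero_of_merge_relations (s : ℕ) (hs : 7 ≤ s) (φ : ℕ → ℚ)
    (hsymm : ∀ k, 1 ≤ k → k < s → φ (s - k) = φ k)
    (hrel : ∀ b c d : ℕ, 1 ≤ b → 1 ≤ c → 1 ≤ d → b + c + d + 1 = s →
      φ (1 + b) + φ (1 + c) + φ (1 + d) + ((s + 3 - 1 : ℚ) / (1 + 2)) * φ 1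
        + ((s + 3 - b : ℚ) / (b + 2)) * φ b + ((s + 3 - c : ℚ) / (c + 2)) * φ c
        + ((s + 3 - d : ℚ) / (d + 2)) * φ d = 0) :
    ∀ k, 1 ≤ k → k < s → φ k = 0 := by
  have hs' : (7 : ℚ) ≤ s := by exact_mod_cast hs
  set H : ℕ → ℚ := fun b => φ (1 + b) + ((s + 3 - b : ℚ) / (b + 2)) * φ b with hH
  obtain ⟨β, hβ⟩ : ∃ β, β = H 2 - H 1 := ⟨_, rfl⟩
  obtain ⟨α, hα⟩ : ∃ α, α = H 1 - β := ⟨_, rfl⟩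
  have hstep : ∀ b, 1 ≤ b → b + 4 ≤ s → H (b + 1) = H b + β := by
    intro b hb hbs
    have h1 := hrel b 2 (s - 3 - b) hb (by norm_num) (by omega) (by omega)
    have h2 := hrel (b + 1) 1 (s - 3 - b) (by omega) (by norm_num) (by omega) (by omega)
    simp only [hβ, hH]
    linarith
  have hlin : ∀ b, 1 ≤ b → b + 3 ≤ s → H b = α + β * b := by
    intro b hb
    induction b, hb using Nat.le_induction with
    | base => intro _; rw [hα]; push_cast; ring
    | succ b hb ih =>
      intro hbs
      rw [hstep b hb (by omega), ih (by omega)]; push_cast; ring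
  obtain ⟨r, hr⟩ : ∃ r, r * (s + 7) = β := ⟨β / (s + 7), by field_simp⟩
  obtain ⟨q, hq⟩ : ∃ q, q * (s + 6) + 5 * r = α + 2 * β :=
    ⟨(α + 2 * β - 5 * r) / (s + 6), by field_simp; ring⟩
  obtain ⟨p, hp⟩ : ∃ p, p * (s + 5) + 2 * q + 2 * r = 2 * α :=
    ⟨(2 * α - 2 * q - 2 * r) / (s + 5), by field_simp; ring⟩
  have hch : ∀ k, k ≤ s + 4 →
      ((s + 4).choose (k + 1) : ℚ) * (k + 1) = (s + 4).choose k * (s + 4 - k) := by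
    intro k hk
    have := Nat.choose_succ_right_eq (s + 4) k
    have h2 : (((s + 4 - k : ℕ)) : ℚ) = s + 4 - k := by push_cast [Nat.cast_sub hk]; ring
    rw [← h2]; exact_mod_cast this
  have hpos : ∀ k, k ≤ s + 4 → (0 : ℚ) < (s + 4).choose k := fun k hk => by
    exact_mod_cast Nat.choose_pos hk
  obtain ⟨κ, hκ⟩ : ∃ κ : ℚ, φ 1 = p + q + r - κ * (s + 4).choose 2 :=
    ⟨(p + q + r - φ 1) / (s + 4).choose 2, by
      have := (hpos 2 (by omega)).ne'; field_simp; ring⟩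
  have hform : ∀ b : ℕ, 1 ≤ b → b + 2 ≤ s →
      φ b = p + q * b + r * b ^ 2 + κ * (-1) ^ b * (s + 4).choose (b + 1) := by
    intro b hb
    induction b, hb using Nat.le_induction with
    | base => intro _; rw [hκ]; push_cast; ring
    | succ b hb ih =>
      intro hbs
      have h1 := hlin b hb (by omega)
      have h2 := ih (by omega)
      have h3 := hch (b + 1) (by omega)
      simp only [hH] at h1
      have hb2 : (b : ℚ) + 2 ≠ 0 := by positivity
      have h4 : (b + 2) * φ (b + 1) = (b + 2) * (α + β * b) - (s + 3 - b) * φ b := by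
        rw [add_comm b 1, ← h1]; field_simp; ring
      apply mul_left_cancel₀ hb2
      rw [h4, h2, pow_succ]
      push_cast at h3 ⊢
      have h5 : ((s + 4).choose (b + 1 + 1) : ℚ) * (b + 2)
        = (s + 4).choose (b + 1) * (s + 3 - b) := by linear_combination h3
      linear_combination (-(b : ℚ) ^ 2) * hr - b * hq - hp + κ * (-1) ^ b * h5
  obtain ⟨l, hl⟩ : ∃ l, l = q + r * s := ⟨_, rfl⟩
  have hsgn : ∀ k, k ≤ s → ((-1 : ℚ)) ^ (s - k) = (-1) ^ s * (-1) ^ k := by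
    intro k hk
    obtain ⟨t, rfl⟩ := Nat.exists_eq_add_of_le hk
    rw [Nat.add_sub_cancel_left, pow_add]
    have : ((-1 : ℚ)) ^ k * (-1) ^ k = 1 := by rw [← mul_pow]; norm_num
    linear_combination (-(-1 : ℚ) ^ t) * this
  have e2 : (s - 4) * l = κ * ((s + 4).choose 3 - (-1) ^ s * (s + 4).choose 5) := by
    have h1 := hform 2 (by norm_num) (by omega)
    have h2 := hform (s - 2) (by omega) (by omega)
    rw [hsymm 2 (by norm_num) (by omega), hsgn 2 (by omega),
      Nat.choose_symm_of_eq_add (show s + 4 = (s - 2 + 1) + 5 by omega),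
      Nat.cast_sub (show 2 ≤ s by omega)] at h2
    push_cast at h1 h2
    rw [hl]; linear_combination h1 - h2
  have e3 : (s - 6) * l = -κ * ((s + 4).choose 4 - (-1) ^ s * (s + 4).choose 6) := by
    have h1 := hform 3 (by norm_num) (by omega)
    have h2 := hform (s - 3) (by omega) (by omega)
    rw [hsymm 3 (by norm_num) (by omega), hsgn 3 (by omega),
      Nat.choose_symm_of_eq_add (show s + 4 = (s - 3 + 1) + 6 by omega),
      Nat.cast_sub (show 3 ≤ s by omega)] at h2
    push_cast at h1 h2
    rw [hl]; linear_combination h1 - h2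
  have p3 := hpos 3 (by omega)
  have p4 := hpos 4 (by omega)
  have p5 := hpos 5 (by omega)
  have p6 := hpos 6 (by omega)
  have c3 := hch 3 (by omega)
  have c4 := hch 4 (by omega)
  have c5 := hch 5 (by omega)
  push_cast at c3 c4 c5
  have hκ0 : κ = 0 := by
    have key : κ * ((s - 6) * ((s + 4).choose 3 - (-1) ^ s * (s + 4).choose 5)
        + (s - 4) * ((s + 4).choose 4 - (-1) ^ s * (s + 4).choose 6)) = 0 := by
      linear_combination (s - 4) * e3 - (s - 6) * e2
    refine (mul_eq_zero.mp key).resolve_right ?_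
    have ha : (0 : ℚ) < s - 6 := by linarith
    have hb : (0 : ℚ) < s - 4 := by linarith
    rcases Nat.even_or_odd s with he | ho
    · rw [he.neg_one_pow]
      have i3 : ((s + 4).choose 3 : ℚ) < (s + 4).choose 4 := by nlinarith
      have i4 : ((s + 4).choose 4 : ℚ) < (s + 4).choose 5 := by nlinarith
      have i5 : ((s + 4).choose 5 : ℚ) ≤ (s + 4).choose 6 := by nlinarith
      have j1 := mul_pos ha (sub_pos.mpr (i3.trans i4))
      have j2 := mul_pos hb (sub_pos.mpr (i4.trans_le i5))
      intro h; linarith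
    · rw [ho.neg_one_pow]
      have j1 := mul_pos ha (add_pos p3 p5)
      have j2 := mul_pos hb (add_pos p4 p6)
      intro h; linarith
  have hl0 : l = 0 := by
    rw [hκ0, zero_mul] at e2
    exact (mul_eq_zero.mp e2).resolve_left (by linarith)
  have hq' : q = -r * s := by linarith
  have hp' : p = -2 * r * (s + 2) := by
    have h5 : (s + 5 : ℚ) ≠ 0 := by positivity
    apply mul_right_cancel₀ h5
    subst hq'
    linear_combination hp - 2 * hq + 4 * hr
  have hval : ∀ b : ℕ, 1 ≤ b → b < s → φ b = -r * (b + 2) * (s + 2 - b) := by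
    have aux : ∀ b : ℕ, 1 ≤ b → b + 2 ≤ s → φ b = -r * (b + 2) * (s + 2 - b) := by
      intro b hb hbs
      rw [hform b hb hbs, hκ0, hp', hq']; ring
    intro b hb hbs
    by_cases h : b + 2 ≤ s
    · exact aux b hb h
    · obtain rfl : b = s - 1 := by omega
      rw [hsymm 1 le_rfl (by omega), aux 1 le_rfl (by omega), Nat.cast_sub (by omega)]
      push_cast; ring
  have hr0 : r = 0 := by
    have h := hrel 1 1 (s - 3) le_rfl le_rfl (by omega) (by omega)
    rw [show 1 + (s - 3) = s - 2 by omega, hval 1 le_rfl (by omega), hval (1 + 1) (by omega) (by omega),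
      hval (s - 2) (by omega) (by omega), hval (s - 3) (by omega) (by omega),
      Nat.cast_sub (show 2 ≤ s by omega), Nat.cast_sub (show 3 ≤ s by omega)] at h
    push_cast at h
    have h7 : (s : ℚ) - 3 + 2 ≠ 0 := by linarith
    field_simp at h
    have h8 : r * (3 * (s + 3) * (s + 4)) = 0 := by linear_combination -h
    exact (mul_eq_zero.mp h8).resolve_right (by positivity)
  intro k h1 h2
  rw [hval k h1 h2, hr0]; ring

theorem codimW_single_add (a : ℕ) (d : ℕ →₀ ℕ) :
    codimW (Finsupp.single a 1 + d) = codimW d + (a + 1) := by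
  rw [codimW, Finsupp.sum_add_index' (by simp) (by intros; ring),
    Finsupp.sum_single_index (by simp)]
  simp [codimW, add_comm]

theorem levelW_single_add (a : ℕ) (d : ℕ →₀ ℕ) :
    levelW (Finsupp.single a 1 + d) = levelW d + a := by
  rw [levelW, Finsupp.sum_add_index' (by simp) (by intros; ring),
    Finsupp.sum_single_index (by simp)]
  simp [levelW, add_comm]

theorem codimW_eq_levelW_add_degree (d : ℕ →₀ ℕ) : codimW d = levelW d + d.degree := by
  rw [codimW, levelW, Finsupp.degree_apply, Finsupp.sum, Finsupp.sum, ← Finset.sum_add_distrib]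
  exact Finset.sum_congr rfl fun _ _ => by ring

theorem exists_eq_single_add {n : ℕ} {d : ℕ →₀ ℕ} (hd : d.degree = n + 1) :
    ∃ a e, d = Finsupp.single a 1 + e ∧ e.degree = n := by
  obtain ⟨a, ha⟩ : ∃ a, d a ≠ 0 := by
    by_contra! h
    have : d = 0 := Finsupp.ext h
    simp [this] at hd
  have h : d = Finsupp.single a 1 + (d - Finsupp.single a 1) := by
    rw [add_tsub_cancel_of_le]
    exact Finsupp.single_le_iff.mpr (Nat.one_le_iff_ne_zero.mpr ha)
  refine ⟨a, _, h, ?_⟩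
  rw [h, map_add, Finsupp.degree_single] at hd
  omega

/-- Multiplication by `X a` raises codimension by `a + 1` and level by `a`. -/
theorem X_mul_mem_Rij {i j : ℕ} (a : ℕ) {p : MvPolynomial ℕ ℚ} (hp : p ∈ Rij i j) :
    X a * p ∈ Rij (i + (a + 1)) (j + a) := by
  induction hp using Submodule.span_induction with
  | mem p h =>
    obtain ⟨d, rfl, rfl, rfl⟩ := h
    exact Submodule.subset_span ⟨Finsupp.single a 1 + d, codimW_single_add a d,
      levelW_single_add a d, by rw [X, monomial_mul, one_mul]⟩
  | zero => simp
  | add p q _ _ hp hq => rw [mul_add]; exact add_mem hp hq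
  | smul c p _ hp => rw [mul_smul_comm]; exact Submodule.smul_mem _ _ hp

theorem one_mem_Rij : (1 : MvPolynomial ℕ ℚ) ∈ Rij 0 0 :=
  Submodule.subset_span ⟨0, by simp [codimW], by simp [levelW], rfl⟩

theorem X_mem_Rij (a : ℕ) : (X a : MvPolynomial ℕ ℚ) ∈ Rij (a + 1) a := by
  simpa using X_mul_mem_Rij a one_mem_Rij

/-- Induction on bihomogeneous polynomials by multiplying with one variable at a time. -/
theorem Rij_induction {P : ℕ → ℕ → MvPolynomial ℕ ℚ → Prop}
    (zero : ∀ i j, P i j 0)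
    (add : ∀ i j p q, P i j p → P i j q → P i j (p + q))
    (smul : ∀ i j (c : ℚ) p, P i j p → P i j (c • p))
    (one : P 0 0 1)
    (X_mul : ∀ i j a p, p ∈ Rij i j → P i j p → P (i + (a + 1)) (j + a) (X a * p))
    {i j : ℕ} {p : MvPolynomial ℕ ℚ} (hp : p ∈ Rij i j) : P i j p := by
  have key : ∀ n, ∀ d : ℕ →₀ ℕ, d.degree = n →
      P (codimW d) (levelW d) (monomial d (1 : ℚ)) := by
    intro n
    induction n with
    | zero =>
      intro d hd
      obtain rfl : d = 0 := (Finsupp.degree_eq_zero_iff d).mp hd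
      simpa [codimW, levelW] using one
    | succ n ih =>
      intro d hd
      obtain ⟨a, e, rfl, he⟩ := exists_eq_single_add hd
      have := X_mul _ _ a _ (Submodule.subset_span ⟨e, rfl, rfl, rfl⟩) (ih e he)
      rwa [X, monomial_mul, one_mul, ← codimW_single_add, ← levelW_single_add] at this
  induction hp using Submodule.span_induction with
  | mem p h => obtain ⟨d, rfl, rfl, rfl⟩ := h; exact key _ d rfl
  | zero => exact zero i j
  | add p q _ _ hp hq => exact add i j p q hp hq
  | smul c p _ hp => exact smul i j c p hp

/-- The operator `Dop g`, with the summation indices cut off at `N`. -/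
def Dcut (g N : ℕ) : MvPolynomial ℕ ℚ →ₗ[ℚ] MvPolynomial ℕ ℚ :=
  -(g : ℚ) • (pderiv (R := ℚ) (0 : ℕ)).toLinearMap +
    (1/2 : ℚ) • ∑ a ∈ Finset.range N, ∑ b ∈ Finset.range N,
      (((a + b + 2).choose (b + 1) : ℚ)) •
        (LinearMap.mulLeft ℚ (X (a + b)) ∘ₗ (pderiv (R := ℚ) a).toLinearMap ∘ₗ
          (pderiv (R := ℚ) b).toLinearMap)

theorem Dcut_apply (g N : ℕ) (p : MvPolynomial ℕ ℚ) :
    Dcut g N p = -(g : ℚ) • pderiv 0 p + (1/2 : ℚ) •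
      ∑ a ∈ Finset.range N, ∑ b ∈ Finset.range N,
        (((a + b + 2).choose (b + 1) : ℚ)) • (X (a + b) * pderiv a (pderiv b p)) := by
  simp [Dcut, LinearMap.sum_apply]

theorem pderiv_comm (a b : ℕ) (p : MvPolynomial ℕ ℚ) :
    pderiv a (pderiv b p) = pderiv b (pderiv a p) := by
  have : ⁅pderiv (R := ℚ) a, pderiv (R := ℚ) b⁆ = 0 := by
    apply MvPolynomial.derivation_ext
    intro i
    classical
    rw [Derivation.commutator_apply, pderiv_X, pderiv_X]
    simp [Pi.single_apply, apply_ite]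
  have h := congrArg (fun D => D p) this
  rw [Derivation.commutator_apply] at h
  exact sub_eq_zero.mp h

theorem Dop_eq_Dcut (g N : ℕ) (p : MvPolynomial ℕ ℚ) (hN : ∀ v ∈ p.vars, v < N) :
    Dop g p = Dcut g N p := by
  have main : ∀ M, (∀ v ∈ p.vars, v < M) → ∀ K, M ≤ K → Dcut g M p = Dcut g K p := by
    intro M hM K hMK
    have h0 : ∀ b, M ≤ b → pderiv b p = 0 := fun b hb =>
      pderiv_eq_zero_of_notMem_vars fun h => absurd (hM b h) (by omega)
    rw [Dcut_apply, Dcut_apply]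
    congr 2
    have hsub : Finset.range M ⊆ Finset.range K := by
      intro x; simp only [Finset.mem_range]; omega
    rw [← Finset.sum_subset hsub]
    · refine Finset.sum_congr rfl fun a _ => Finset.sum_subset hsub fun b _ hb => ?_
      rw [h0 b (by simpa using hb)]; simp
    · intro a _ ha
      refine Finset.sum_eq_zero fun b _ => ?_
      rw [pderiv_comm, h0 a (by simpa using ha)]; simp
  have hsup : ∀ v ∈ p.vars, v < p.vars.sup id + 1 := fun v hv =>
    Nat.lt_succ_of_le (Finset.le_sup (f := id) hv)
  have h1 : Dop g p = Dcut g (p.vars.sup id + 1) p := (Dcut_apply g _ p).symm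
  rw [h1, main _ hsup _ (le_max_left _ N), main N hN _ (le_max_right _ _)]

theorem exists_vars_lt (p : MvPolynomial ℕ ℚ) (a : ℕ) : ∃ N, a < N ∧ ∀ v ∈ p.vars, v < N :=
  ⟨max (a + 1) (p.vars.sup id + 1), by omega, fun v hv => by
    have := Finset.le_sup (f := id) hv
    simp only [id] at this
    omega⟩

theorem Dop_add (g : ℕ) (p q : MvPolynomial ℕ ℚ) : Dop g (p + q) = Dop g p + Dop g q := by
  classical
  obtain ⟨N, -, hp⟩ := exists_vars_lt p 0
  obtain ⟨M, hM, hq⟩ := exists_vars_lt q N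
  have hp' : ∀ v ∈ p.vars, v < M := fun v hv => (hp v hv).trans hM
  rw [Dop_eq_Dcut g M _ hp', Dop_eq_Dcut g M _ hq, ← map_add]
  refine Dop_eq_Dcut g M _ fun v hv => ?_
  rcases Finset.mem_union.mp (vars_add_subset p q hv) with h | h
  exacts [hp' v h, hq v h]

theorem Dop_smul (g : ℕ) (c : ℚ) (p : MvPolynomial ℕ ℚ) : Dop g (c • p) = c • Dop g p := by
  obtain ⟨N, -, hp⟩ := exists_vars_lt p 0
  rw [Dop_eq_Dcut g N _ hp, ← map_smul]
  refine Dop_eq_Dcut g N _ fun v hv => hp v ?_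
  rw [mem_vars_iff_mem_support] at hv ⊢
  obtain ⟨d, hd, hv⟩ := hv
  refine ⟨d, ?_, hv⟩
  rw [mem_support_iff] at hd ⊢
  rw [coeff_smul] at hd
  exact right_ne_zero_of_mul hd

/-- `Dop g` as a linear map. -/
def Dlin (g : ℕ) : MvPolynomial ℕ ℚ →ₗ[ℚ] MvPolynomial ℕ ℚ where
  toFun := Dop g
  map_add' := Dop_add g
  map_smul' := Dop_smul g

/-- The derivation `x_b ↦ binom(a+b+2, b+1) x_{a+b}`, which is the commutator of the second order part
of `Dop` with multiplication by `X a`. -/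
def mergeDer (a : ℕ) : Derivation ℚ (MvPolynomial ℕ ℚ) (MvPolynomial ℕ ℚ) :=
  mkDerivation ℚ fun b => ((a + b + 2).choose (b + 1) : ℚ) • X (a + b)

theorem mergeDer_X (a b : ℕ) :
    mergeDer a (X b) = ((a + b + 2).choose (b + 1) : ℚ) • X (a + b) :=
  mkDerivation_X _ _ _

theorem mergeDer_eq_sum (a N : ℕ) (p : MvPolynomial ℕ ℚ) (hN : ∀ v ∈ p.vars, v < N) :
    mergeDer a p = ∑ b ∈ Finset.range N,
      ((a + b + 2).choose (b + 1) : ℚ) • (X (a + b) * pderiv b p) := by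
  classical
  have hcoe : ∀ (s : Finset ℕ) (D : ℕ → Derivation ℚ (MvPolynomial ℕ ℚ) (MvPolynomial ℕ ℚ)) q,
      (∑ b ∈ s, D b) q = ∑ b ∈ s, D b q := fun s D q => by
    rw [← Derivation.coeFnAddMonoidHom_apply, map_sum, Finset.sum_apply]; rfl
  have := derivation_eq_of_forall_mem_vars (D₁ := mergeDer a)
    (D₂ := ∑ b ∈ Finset.range N,
      (((a + b + 2).choose (b + 1) : ℚ) • (X (a + b) : MvPolynomial ℕ ℚ)) • pderiv (R := ℚ) b)
    (f := p) ?_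
  · rw [this, hcoe]
    simp
  · intro v hv
    rw [mergeDer_X, hcoe, Finset.sum_eq_single v]
    · simp
    · intro b _ hb
      simp [pderiv_X_of_ne hb.symm]
    · intro h; exact absurd (hN v hv) (by simpa using h)

theorem Dlin_X_mul (g a : ℕ) (p : MvPolynomial ℕ ℚ) :
    Dlin g (X a * p) = X a * Dlin g p + (if a = 0 then -(g : ℚ) else 0) • p + mergeDer a p := by
  classical
  obtain ⟨N, ha, hp⟩ := exists_vars_lt p a
  have hXp : ∀ v ∈ (X a * p).vars, v < N := by
    intro v hv
    rcases Finset.mem_union.mp (vars_mul _ _ hv) with h | h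
    · rw [vars_X, Finset.mem_singleton] at h; omega
    · exact hp v h
  change Dop g _ = X a * Dop g p + _ + _
  rw [Dop_eq_Dcut g N _ hXp, Dop_eq_Dcut g N _ hp, Dcut_apply, Dcut_apply]
  have hpd : ∀ b q, pderiv b (X a * q : MvPolynomial ℕ ℚ)
      = X a * pderiv b q + if b = a then q else 0 := by
    intro b q
    rw [pderiv_mul, pderiv_X]
    by_cases h : b = a
    · subst h; simp [add_comm]
    · simp [h, Ne.symm h]
  have hsum : ∑ c ∈ Finset.range N, ∑ b ∈ Finset.range N, (((c + b + 2).choose (b + 1) : ℚ)) •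
        (X (c + b) * pderiv c (pderiv b (X a * p)))
      = X a * (∑ c ∈ Finset.range N, ∑ b ∈ Finset.range N, (((c + b + 2).choose (b + 1) : ℚ)) •
        (X (c + b) * pderiv c (pderiv b p))) + 2 * mergeDer a p := by
    have hterm : ∀ c b, (((c + b + 2).choose (b + 1) : ℚ)) •
        (X (c + b) * pderiv c (pderiv b (X a * p)))
        = X a * ((((c + b + 2).choose (b + 1) : ℚ)) • (X (c + b) * pderiv c (pderiv b p)))
          + (if c = a then (((c + b + 2).choose (b + 1) : ℚ)) • (X (c + b) * pderiv b p) else 0)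
          + (if b = a then (((c + b + 2).choose (b + 1) : ℚ)) • (X (c + b) * pderiv c p) else 0) := by
      intro c b
      rw [hpd, map_add, hpd]
      simp only [smul_eq_C_mul]
      split_ifs <;> simp <;> ring
    simp only [hterm, Finset.sum_add_distrib, Finset.mul_sum]
    rw [two_mul, add_assoc]
    congr 2
    · rw [Finset.sum_eq_single a]
      · simp only [if_true]
        exact (mergeDer_eq_sum a N p hp).symm
      · intro c _ hc; simp [hc]
      · intro h; simp [ha] at h
    · rw [mergeDer_eq_sum a N p hp]
      refine Finset.sum_congr rfl fun c _ => ?_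
      rw [Finset.sum_ite_eq' (Finset.range N) a, if_pos (by simpa using ha), add_comm c a]
      congr 2
      rw [← Nat.choose_symm_of_eq_add (show a + c + 2 = (c + 1) + (a + 1) by ring)]
  rw [hsum, hpd]
  have h2 : (C (1 / 2) : MvPolynomial ℕ ℚ) * 2 = 1 := by
    rw [show (2 : MvPolynomial ℕ ℚ) = C 2 from (map_ofNat C 2).symm, ← C_mul]; norm_num
  simp only [smul_eq_C_mul]
  by_cases h : a = 0
  · simp only [h, if_true]
    linear_combination mergeDer 0 p * h2
  · simp only [h, if_false, Ne.symm h, C_0]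
    linear_combination mergeDer a p * h2

theorem Dlin_one (g : ℕ) : Dlin g 1 = 0 := by
  change Dop g 1 = 0
  rw [Dop_eq_Dcut g 0 1 (by simp [vars_one]), Dcut_apply]
  simp

theorem mergeDer_mem_Rij (a : ℕ) {i j : ℕ} {p : MvPolynomial ℕ ℚ} (hp : p ∈ Rij i j) :
    mergeDer a p ∈ Rij (i + a) (j + a) := by
  refine Rij_induction (P := fun i j p => mergeDer a p ∈ Rij (i + a) (j + a))
    ?_ ?_ ?_ ?_ ?_ hp
  · simp
  · intro i j p q hp hq; rw [map_add]; exact add_mem hp hq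
  · intro i j c p hp; rw [Derivation.map_smul]; exact Submodule.smul_mem _ _ hp
  · simp
  · intro i j b p hp ih
    rw [Derivation.leibniz, mergeDer_X, smul_eq_mul, smul_eq_mul, mul_smul_comm]
    refine add_mem ?_ (Submodule.smul_mem _ _ ?_)
    · convert X_mul_mem_Rij b ih using 1
      congr 1 <;> ring
    · rw [mul_comm]
      convert X_mul_mem_Rij (a + b) hp using 1
      congr 1 <;> ring

theorem mergeDer_zero_apply {i j : ℕ} {p : MvPolynomial ℕ ℚ} (hp : p ∈ Rij i j) :
    mergeDer 0 p = (2 * i - j : ℚ) • p := by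
  refine Rij_induction (P := fun i j p => mergeDer 0 p = (2 * i - j : ℚ) • p)
    ?_ ?_ ?_ ?_ ?_ hp
  · simp
  · intro i j p q hp hq; rw [map_add, hp, hq, smul_add]
  · intro i j c p hp; rw [Derivation.map_smul, hp, smul_comm]
  · simp
  · intro i j b p hp ih
    rw [Derivation.leibniz, mergeDer_X, ih, zero_add,
      Nat.choose_symm_of_eq_add (show b + 2 = (b + 1) + 1 by ring), Nat.choose_one_right]
    have h2 : (C 2 : MvPolynomial ℕ ℚ) = 2 := map_ofNat C 2
    simp only [smul_eq_mul, smul_eq_C_mul]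
    push_cast
    simp only [map_add, map_sub, map_mul, map_natCast, map_one, h2]
    ring

theorem Dlin_mem_Rij_aux (g : ℕ) {i j : ℕ} {p : MvPolynomial ℕ ℚ} (hp : p ∈ Rij i j) :
    (i = 0 → Dlin g p = 0) ∧ ∀ i', i = i' + 1 → Dlin g p ∈ Rij i' j := by
  refine Rij_induction
    (P := fun i j p => (i = 0 → Dlin g p = 0) ∧ ∀ i', i = i' + 1 → Dlin g p ∈ Rij i' j)
    ?_ ?_ ?_ ?_ ?_ hp
  · simp
  · intro i j p q hp hq
    refine ⟨fun h => by rw [map_add, hp.1 h, hq.1 h, add_zero], fun i' h => ?_⟩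
    rw [map_add]; exact add_mem (hp.2 i' h) (hq.2 i' h)
  · intro i j c p hp
    refine ⟨fun h => by rw [map_smul, hp.1 h, smul_zero], fun i' h => ?_⟩
    rw [map_smul]; exact Submodule.smul_mem _ _ (hp.2 i' h)
  · simp [Dlin_one]
  · intro i j a p hp ih
    refine ⟨fun h => by omega, fun i' h => ?_⟩
    obtain rfl : i' = i + a := by omega
    rw [Dlin_X_mul]
    refine add_mem (add_mem ?_ ?_) (mergeDer_mem_Rij a hp)
    · rcases i with _ | i
      · rw [ih.1 rfl, mul_zero]; exact zero_mem _
      · convert X_mul_mem_Rij a (ih.2 i rfl) using 1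
        congr 1; ring
    · split_ifs with ha
      · subst ha; exact Submodule.smul_mem _ _ hp
      · rw [zero_smul]; exact zero_mem _

theorem Dlin_mem_Rij (g : ℕ) {i j : ℕ} {p : MvPolynomial ℕ ℚ} (hp : p ∈ Rij (i + 1) j) :
    Dlin g p ∈ Rij i j :=
  (Dlin_mem_Rij_aux g hp).2 i rfl

/-- The commutator of `𝒟` with multiplication by `x₁` acts by a scalar on each bigraded piece. -/
theorem Dlin_X_zero_mul (g : ℕ) {i j : ℕ} {p : MvPolynomial ℕ ℚ} (hp : p ∈ Rij i j) :
    Dlin g (X 0 * p) = X 0 * Dlin g p + (2 * i - j - g : ℚ) • p := by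
  rw [Dlin_X_mul, mergeDer_zero_apply hp, if_pos rfl, add_assoc, ← add_smul]
  congr 2
  ring

open Nat in
/-- The rescaled variables `u_a = (a+2)! x_{a+1}`, in which merging has multiplicative weights. -/
def mergeVar (a : ℕ) : MvPolynomial ℕ ℚ := ((a + 2)! : ℚ) • X a

theorem mergeVar_mul_mem_Rij {i j : ℕ} (a : ℕ) {p : MvPolynomial ℕ ℚ} (hp : p ∈ Rij i j) :
    mergeVar a * p ∈ Rij (i + (a + 1)) (j + a) := by
  rw [mergeVar, smul_mul_assoc]
  exact Submodule.smul_mem _ _ (X_mul_mem_Rij a hp)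

theorem mergeVar_mem_Rij (a : ℕ) : mergeVar a ∈ Rij (a + 1) a :=
  Submodule.smul_mem _ _ (X_mem_Rij a)

open Nat in
theorem factorial_smul_mergeDer_mergeVar (a b : ℕ) :
    ((a + 2)! : ℚ) • mergeDer a (mergeVar b)
      = ((a + 2 : ℚ) * (b + 2)) • mergeVar (a + b) := by
  rw [mergeVar, mergeVar, Derivation.map_smul, mergeDer_X, smul_smul, smul_smul, smul_smul]
  congr 1
  have h := Nat.add_choose_mul_factorial_mul_factorial (a + 1) (b + 1)
  rw [show a + 1 + (b + 1) = a + b + 2 by ring] at h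
  have h' : ((a + b + 2).choose (b + 1) : ℚ) * (a + 1)! * (b + 1)! = (a + b + 2)! := by
    exact_mod_cast h
  rw [← h', Nat.factorial_succ (a + 1), Nat.factorial_succ (b + 1)]
  push_cast
  ring

theorem Dlin_mergeVar (g : ℕ) {a : ℕ} (ha : 1 ≤ a) : Dlin g (mergeVar a) = 0 := by
  have h := Dlin_X_mul g a 1
  rw [mul_one, Dlin_one, if_neg (by omega)] at h
  rw [mergeVar, map_smul, h]
  simp

open Nat in
theorem Dlin_mergeVar_mul (g : ℕ) {a : ℕ} (ha : 1 ≤ a) (p : MvPolynomial ℕ ℚ) :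
    Dlin g (mergeVar a * p) = mergeVar a * Dlin g p + ((a + 2)! : ℚ) • mergeDer a p := by
  rw [mergeVar, smul_mul_assoc, map_smul, Dlin_X_mul, if_neg (by omega), zero_smul, add_zero,
    smul_add, smul_mul_assoc]

theorem factorial_smul_mergeDer_mul (a b : ℕ) (p : MvPolynomial ℕ ℚ) :
    ((a + 2).factorial : ℚ) • mergeDer a (mergeVar b * p)
      = mergeVar b * (((a + 2).factorial : ℚ) • mergeDer a p)
        + ((a + 2 : ℚ) * (b + 2)) • (mergeVar (a + b) * p) := by
  rw [← smul_mul_assoc ((a + 2 : ℚ) * (b + 2)), ← factorial_smul_mergeDer_mergeVar,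
    Derivation.leibniz]
  simp only [smul_eq_mul, smul_eq_C_mul]
  ring

theorem Dlin_mergeVar_two (g : ℕ) {a b : ℕ} (ha : 1 ≤ a) (hb : 1 ≤ b) :
    Dlin g (mergeVar a * mergeVar b) = ((a + 2 : ℚ) * (b + 2)) • mergeVar (a + b) := by
  rw [Dlin_mergeVar_mul g ha, Dlin_mergeVar g hb, factorial_smul_mergeDer_mergeVar]
  simp

theorem Dlin_mergeVar_three (g : ℕ) {a b c : ℕ} (ha : 1 ≤ a) (hb : 1 ≤ b) (hc : 1 ≤ c) :
    Dlin g (mergeVar a * (mergeVar b * mergeVar c))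
      = ((a + 2 : ℚ) * (b + 2)) • (mergeVar (a + b) * mergeVar c)
        + ((a + 2 : ℚ) * (c + 2)) • (mergeVar b * mergeVar (a + c))
        + ((b + 2 : ℚ) * (c + 2)) • (mergeVar a * mergeVar (b + c)) := by
  rw [Dlin_mergeVar_mul g ha, Dlin_mergeVar_two g hb hc, factorial_smul_mergeDer_mul,
    factorial_smul_mergeDer_mergeVar]
  simp only [mul_smul_comm]
  abel

theorem Dlin_mergeVar_four (g : ℕ) {a b c d : ℕ} (ha : 1 ≤ a) (hb : 1 ≤ b) (hc : 1 ≤ c)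
    (hd : 1 ≤ d) :
    Dlin g (mergeVar a * (mergeVar b * (mergeVar c * mergeVar d)))
      = ((a + 2 : ℚ) * (b + 2)) • (mergeVar (a + b) * (mergeVar c * mergeVar d))
        + ((a + 2 : ℚ) * (c + 2)) • (mergeVar b * (mergeVar (a + c) * mergeVar d))
        + ((a + 2 : ℚ) * (d + 2)) • (mergeVar b * (mergeVar c * mergeVar (a + d)))
        + ((b + 2 : ℚ) * (c + 2)) • (mergeVar a * (mergeVar (b + c) * mergeVar d))
        + ((b + 2 : ℚ) * (d + 2)) • (mergeVar a * (mergeVar c * mergeVar (b + d)))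
        + ((c + 2 : ℚ) * (d + 2)) • (mergeVar a * (mergeVar b * mergeVar (c + d))) := by
  rw [Dlin_mergeVar_mul g ha, Dlin_mergeVar_three g hb hc hd, factorial_smul_mergeDer_mul,
    factorial_smul_mergeDer_mul, factorial_smul_mergeDer_mergeVar]
  simp only [mul_smul_comm, mul_add]
  abel

theorem Dlin_sq_mergeVar_four (g : ℕ) {a b c d : ℕ} (ha : 1 ≤ a) (hb : 1 ≤ b) (hc : 1 ≤ c)
    (hd : 1 ≤ d) :
    Dlin g (Dlin g (mergeVar a * (mergeVar b * (mergeVar c * mergeVar d))))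
      = (2 * (a + 2 : ℚ) * (b + 2) * (c + 2) * (d + 2)) •
          (mergeVar (a + b) * mergeVar (c + d) + mergeVar (a + c) * mergeVar (b + d)
            + mergeVar (a + d) * mergeVar (b + c))
        + (2 * (a + 2 : ℚ) * (b + 2) * (c + 2) * (a + b + c + 3)) •
          (mergeVar d * mergeVar (a + b + c))
        + (2 * (a + 2 : ℚ) * (b + 2) * (d + 2) * (a + b + d + 3)) •
          (mergeVar c * mergeVar (a + b + d))
        + (2 * (a + 2 : ℚ) * (c + 2) * (d + 2) * (a + c + d + 3)) •
          (mergeVar b * mergeVar (a + c + d))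
        + (2 * (b + 2 : ℚ) * (c + 2) * (d + 2) * (b + c + d + 3)) •
          (mergeVar a * mergeVar (b + c + d)) := by
  have hh : ∀ x y : ℕ, 1 ≤ x → 1 ≤ x + y := fun x y h => by omega
  have h2 : (C 2 : MvPolynomial ℕ ℚ) = 2 := map_ofNat C 2
  have h3 : (C 3 : MvPolynomial ℕ ℚ) = 3 := map_ofNat C 3
  rw [Dlin_mergeVar_four g ha hb hc hd]
  simp only [map_add, map_smul]
  rw [Dlin_mergeVar_three g (hh a b ha) hc hd, Dlin_mergeVar_three g hb (hh a c ha) hd,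
    Dlin_mergeVar_three g hb hc (hh a d ha), Dlin_mergeVar_three g ha (hh b c hb) hd,
    Dlin_mergeVar_three g ha hc (hh b d hb), Dlin_mergeVar_three g ha hb (hh c d hc),
    show b + (a + c) = a + b + c by ring, show b + (a + d) = a + b + d by ring,
    show c + (a + d) = a + c + d by ring, show a + (b + c) = a + b + c by ring,
    show a + (b + d) = a + b + d by ring, show c + (b + d) = b + c + d by ring,
    show a + (c + d) = a + c + d by ring, show b + (c + d) = b + c + d by ring]
  push_cast
  simp only [smul_eq_C_mul, map_add, map_mul, map_natCast, h2, h3]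
  ring

/-- Merging four rescaled variables completely gives a positive multiple of a single one. -/
theorem exists_pos_Dlin_cube_mergeVar_four (g : ℕ) {a b c d : ℕ} (ha : 1 ≤ a) (hb : 1 ≤ b)
    (hc : 1 ≤ c) (hd : 1 ≤ d) :
    ∃ r : ℚ, 0 < r ∧ Dlin g (Dlin g (Dlin g (mergeVar a * (mergeVar b * (mergeVar c * mergeVar d)))))
      = r • mergeVar (a + b + c + d) := by
  have hh : ∀ x y : ℕ, 1 ≤ x → 1 ≤ x + y := fun x y h => by omega
  rw [Dlin_sq_mergeVar_four g ha hb hc hd]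
  simp only [map_add, map_smul]
  rw [Dlin_mergeVar_two g (hh a b ha) (hh c d hc), Dlin_mergeVar_two g (hh a c ha) (hh b d hb),
    Dlin_mergeVar_two g (hh a d ha) (hh b c hb), Dlin_mergeVar_two g hd (hh _ c (hh a b ha)),
    Dlin_mergeVar_two g hc (hh _ d (hh a b ha)), Dlin_mergeVar_two g hb (hh _ d (hh a c ha)),
    Dlin_mergeVar_two g ha (hh _ d (hh b c hb)),
    show a + b + (c + d) = a + b + c + d by ring, show a + c + (b + d) = a + b + c + d by ring,
    show a + d + (b + c) = a + b + c + d by ring, show d + (a + b + c) = a + b + c + d by ring,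
    show c + (a + b + d) = a + b + c + d by ring, show b + (a + c + d) = a + b + c + d by ring,
    show a + (b + c + d) = a + b + c + d by ring]
  simp only [smul_smul, ← add_smul]
  exact ⟨_, by positivity, rfl⟩

/-- `𝒟ⁿ(R^g_{(j)})`. -/
def descend (g j n : ℕ) : Submodule ℚ (MvPolynomial ℕ ℚ) := (Rij g j).map (Dlin g ^ n)

theorem descend_le_Ipol (g n : ℕ) {j : ℕ} (hj : 1 ≤ j) : descend g j n ≤ Ipol g := by
  rintro _ ⟨p, hp, rfl⟩
  refine Submodule.mem_sup_right (Submodule.mem_iSup_of_mem n (Submodule.subset_span ⟨p, ?_, ?_⟩))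
  · refine Submodule.span_mono ?_ hp
    rintro _ ⟨d, h1, h2, rfl⟩
    exact ⟨d, h1, h2 ▸ hj, rfl⟩
  · rw [Module.End.pow_apply]; rfl

theorem Dlin_mem_descend {g j n : ℕ} {p : MvPolynomial ℕ ℚ} (hp : p ∈ descend g j n) :
    Dlin g p ∈ descend g j (n + 1) := by
  obtain ⟨q, hq, rfl⟩ := hp
  exact ⟨q, hq, by rw [pow_succ', Module.End.mul_apply]⟩

theorem mem_descend_zero {g j : ℕ} {p : MvPolynomial ℕ ℚ} (hp : p ∈ Rij g j) :
    p ∈ descend g j 0 := ⟨p, hp, by simp⟩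

theorem descend_le_Rij (g j n : ℕ) : ∀ i, i + n = g → descend g j n ≤ Rij i j := by
  induction n with
  | zero => rintro i rfl _ ⟨p, hp, rfl⟩; simpa using hp
  | succ n ih =>
    rintro i hi _ ⟨p, hp, rfl⟩
    rw [pow_succ', Module.End.mul_apply]
    exact Dlin_mem_Rij g (ih (i + 1) (by omega) ⟨p, hp, rfl⟩)

theorem exists_Dlin_eq {g j n : ℕ} {p : MvPolynomial ℕ ℚ} (hp : p ∈ descend g j (n + 1)) :
    ∃ q ∈ descend g j n, Dlin g q = p := by
  obtain ⟨y, hy, rfl⟩ := hp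
  exact ⟨_, ⟨y, hy, rfl⟩, by rw [pow_succ', Module.End.mul_apply]⟩

theorem Dlin_cube_X_zero_mul (j : ℕ) {p : MvPolynomial ℕ ℚ} (hp : p ∈ Rij (j + 4) j) :
    Dlin (j + 5) (Dlin (j + 5) (Dlin (j + 5) (X 0 * p)))
      = X 0 * Dlin (j + 5) (Dlin (j + 5) (Dlin (j + 5) p))
        + (3 : ℚ) • Dlin (j + 5) (Dlin (j + 5) p) := by
  have h1 : Dlin (j + 5) p ∈ Rij (j + 3) j := Dlin_mem_Rij _ hp
  have h2 : Dlin (j + 5) (Dlin (j + 5) p) ∈ Rij (j + 2) j := Dlin_mem_Rij _ h1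
  rw [Dlin_X_zero_mul _ hp, map_add, map_smul, Dlin_X_zero_mul _ h1, map_add, map_add, map_smul,
    map_smul, Dlin_X_zero_mul _ h2]
  push_cast
  module

theorem X_zero_mul_mem_Rij {i j : ℕ} {p : MvPolynomial ℕ ℚ} (hp : p ∈ Rij i j) :
    X 0 * p ∈ Rij (i + 1) j := by simpa using X_mul_mem_Rij 0 hp

theorem X_zero_mul_mergeVar_mem_descend (k : ℕ) :
    X 0 * mergeVar (k + 5) ∈ descend (k + 5 + 5) (k + 5) 3 := by
  obtain ⟨g, hg⟩ : ∃ g, g = k + 5 + 5 := ⟨_, rfl⟩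
  set p := mergeVar 1 * (mergeVar 1 * (mergeVar 1 * (mergeVar 1 * mergeVar (k + 1)))) with hp
  have hpR : p ∈ Rij (k + 5 + 5) (k + 5) := by
    convert mergeVar_mul_mem_Rij 1 (mergeVar_mul_mem_Rij 1 (mergeVar_mul_mem_Rij 1
      (mergeVar_mul_mem_Rij 1 (mergeVar_mem_Rij (k + 1))))) using 2
  have hDp : Dlin (k + 5 + 5) p ∈ Rij (k + 5 + 4) (k + 5) := Dlin_mem_Rij _ hpR
  have h1 := Dlin_mem_descend (Dlin_mem_descend (Dlin_mem_descend
    (mem_descend_zero (g := k + 5 + 5) (X_zero_mul_mem_Rij hDp))))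
  rw [Dlin_cube_X_zero_mul _ hDp] at h1
  have h2 := Dlin_mem_descend (Dlin_mem_descend (Dlin_mem_descend (mem_descend_zero hpR)))
  have h3 := (Submodule.add_mem_iff_left _ (Submodule.smul_mem _ 3 h2)).mp h1
  rw [← hg] at h3 ⊢
  have h4 : Dlin g p = (54 : ℚ) • (mergeVar 2 * (mergeVar 1 * (mergeVar 1 * mergeVar (k + 1))))
      + (12 * (k + 3) : ℚ) •
        (mergeVar 1 * (mergeVar 1 * (mergeVar 1 * mergeVar (1 + (k + 1))))) := by
    have c1 : (C 12 : MvPolynomial ℕ ℚ) = 12 := map_ofNat C 12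
    have c2 : (C 2 : MvPolynomial ℕ ℚ) = 2 := map_ofNat C 2
    have c3 : (C 3 : MvPolynomial ℕ ℚ) = 3 := map_ofNat C 3
    have c4 : (C 54 : MvPolynomial ℕ ℚ) = 54 := map_ofNat C 54
    rw [hp, Dlin_mergeVar_mul g le_rfl, Dlin_mergeVar_four g le_rfl le_rfl le_rfl (by omega),
      factorial_smul_mergeDer_mul, factorial_smul_mergeDer_mul, factorial_smul_mergeDer_mul,
      factorial_smul_mergeDer_mergeVar]
    push_cast
    simp only [smul_eq_C_mul, map_add, map_mul, map_natCast, c1, c2, c3, c4, map_one]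
    norm_num
    ring
  obtain ⟨r, hr, e1⟩ := exists_pos_Dlin_cube_mergeVar_four g (a := 2) (b := 1) (c := 1)
    (d := k + 1) (by omega) (by omega) (by omega) (by omega)
  obtain ⟨t, ht, e2⟩ := exists_pos_Dlin_cube_mergeVar_four g (a := 1) (b := 1) (c := 1)
    (d := 1 + (k + 1)) (by omega) (by omega) (by omega) (by omega)
  rw [h4] at h3
  simp only [map_add, map_smul] at h3
  rw [e1, e2, show 2 + 1 + 1 + (k + 1) = k + 5 by ring,
    show 1 + 1 + 1 + (1 + (k + 1)) = k + 5 by ring, smul_smul, smul_smul, ← add_smul,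
    mul_smul_comm] at h3
  exact (Submodule.smul_mem_iff _ (by positivity)).mp h3

theorem mergeVar_mul_mergeVar_mem_descend {j : ℕ} (hj : 7 ≤ j) {k : ℕ} (hk : 1 ≤ k) (hkj : k < j) :
    mergeVar k * mergeVar (j - k) ∈ descend (j + 5) j 3 := by
  by_contra hmem
  obtain ⟨f, hf, hker⟩ := Submodule.exists_le_ker_of_notMem hmem
  have hf0 : ∀ p ∈ descend (j + 5) j 3, f p = 0 := fun p hp => hker hp
  refine hf (eq_zero_of_merge_relations j hj (fun k => f (mergeVar k * mergeVar (j - k)))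
    (fun k h1 h2 => ?_) (fun b c d hb hc hd hs => ?_) k hk hkj)
  · rw [mul_comm, Nat.sub_sub_self h2.le]
  · have hw : mergeVar 1 * (mergeVar b * (mergeVar c * mergeVar d)) ∈ Rij (j + 4) j := by
      convert mergeVar_mul_mem_Rij 1 (mergeVar_mul_mem_Rij b (mergeVar_mul_mem_Rij c
        (mergeVar_mem_Rij d))) using 2 <;> omega
    have h1 := hf0 _ (Dlin_mem_descend (Dlin_mem_descend (Dlin_mem_descend
      (mem_descend_zero (g := j + 5) (X_zero_mul_mem_Rij hw)))))
    have hX := X_zero_mul_mergeVar_mem_descend (j - 5)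
    rw [Nat.sub_add_cancel (by omega)] at hX
    obtain ⟨r, -, e⟩ := exists_pos_Dlin_cube_mergeVar_four (j + 5) le_rfl hb hc hd
    rw [Dlin_cube_X_zero_mul _ hw, e, show 1 + b + c + d = j by omega, mul_smul_comm, map_add,
      map_smul, hf0 _ hX, smul_zero, zero_add, map_smul, smul_eq_mul,
      Dlin_sq_mergeVar_four _ le_rfl hb hc hd] at h1
    have h2 := (mul_eq_zero.mp h1).resolve_left (by norm_num)
    simp only [map_add, map_smul, smul_eq_mul] at h2
    rw [show j - (1 + b) = c + d by omega, show j - (1 + c) = b + d by omega,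
      show j - (1 + d) = b + c by omega, show j - 1 = b + c + d by omega,
      show j - b = 1 + c + d by omega, show j - c = 1 + b + d by omega,
      show j - d = 1 + b + c by omega]
    have hs' : (j : ℚ) = b + c + d + 1 := by exact_mod_cast hs.symm
    rw [hs']
    have hW : (2 * (1 + 2 : ℚ) * (b + 2) * (c + 2) * (d + 2)) ≠ 0 := by positivity
    refine (mul_eq_zero.mp ?_).resolve_left hW
    push_cast at h2
    rw [← h2]
    field_simp
    ring

theorem X_mem_iff_mergeVar_mem (S : Submodule ℚ (MvPolynomial ℕ ℚ)) (a : ℕ)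
    (p : MvPolynomial ℕ ℚ) : X a * p ∈ S ↔ mergeVar a * p ∈ S := by
  rw [mergeVar, smul_mul_assoc]
  exact (Submodule.smul_mem_iff _ (by exact_mod_cast Nat.factorial_ne_zero _)).symm

theorem Rij_le_descend_three {j : ℕ} (hj : 7 ≤ j) : Rij (j + 2) j ≤ descend (j + 5) j 3 := by
  have hX : ∀ a b, a ≤ b → a + b = j → X a * X b ∈ descend (j + 5) j 3 := by
    intro a b hab hs
    rw [mul_comm, X_mem_iff_mergeVar_mem, mul_comm]
    rcases Nat.eq_zero_or_pos a with rfl | ha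
    · have h := X_zero_mul_mergeVar_mem_descend (j - 5)
      rw [Nat.sub_add_cancel (by omega)] at h
      rw [zero_add] at hs
      subst hs; exact h
    · rw [X_mem_iff_mergeVar_mem, show b = j - a by omega]
      exact mergeVar_mul_mergeVar_mem_descend hj ha (by omega)
  refine Submodule.span_le.mpr ?_
  rintro _ ⟨d, h1, h2, rfl⟩
  have hdeg := codimW_eq_levelW_add_degree d
  obtain ⟨a, e, rfl, he⟩ := exists_eq_single_add (show d.degree = 1 + 1 by omega)
  obtain ⟨b, e', rfl, he'⟩ := exists_eq_single_add (show e.degree = 0 + 1 by omega)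
  obtain rfl := (Finsupp.degree_eq_zero_iff e').mp he'
  have hl : a + b = j := by
    rw [← h2, levelW_single_add, levelW_single_add]; simp [levelW, add_comm]
  have hm : monomial (Finsupp.single a 1 + (Finsupp.single b 1 + 0)) (1 : ℚ) = X a * X b := by
    rw [X, X, monomial_mul, one_mul, add_zero]
  rw [hm]
  rcases le_total a b with h | h
  · exact hX a b h hl
  · rw [mul_comm]; exact hX b a h (by omega)

theorem Rij_le_descend_four {j : ℕ} (hj : 7 ≤ j) : Rij (j + 1) j ≤ descend (j + 5) j 4 := by
  refine Submodule.span_le.mpr ?_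
  rintro _ ⟨d, h1, h2, rfl⟩
  have hdeg := codimW_eq_levelW_add_degree d
  obtain ⟨a, e, rfl, he⟩ := exists_eq_single_add (show d.degree = 0 + 1 by omega)
  obtain rfl := (Finsupp.degree_eq_zero_iff e).mp he
  obtain rfl : a = j := by
    rw [← h2, levelW_single_add]; simp [levelW]
  have hD : Dlin (a + 5) (X a) = 0 := by
    have h := Dlin_X_mul (a + 5) a 1
    rw [mul_one, Dlin_one, if_neg (by omega)] at h
    simpa using h
  have h := Dlin_mem_descend (Rij_le_descend_three hj (X_zero_mul_mem_Rij (X_mem_Rij a)))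
  rw [Dlin_X_zero_mul _ (X_mem_Rij a), hD, mul_zero, zero_add] at h
  rw [add_zero]
  refine (Submodule.smul_mem_iff _ ?_).mp h
  push_cast
  ring_nf
  norm_num

theorem Rij_le_descend_two {j : ℕ} (hj : 7 ≤ j) : Rij (j + 3) j ≤ descend (j + 5) j 2 := by
  intro v hv
  obtain ⟨q, hq, hqv⟩ := exists_Dlin_eq (Rij_le_descend_three hj (Dlin_mem_Rij (j + 5) hv))
  rw [← sub_add_cancel v q]
  refine add_mem ?_ hq
  have hw : v - q ∈ Rij (j + 3) j := sub_mem hv (descend_le_Rij _ _ 2 _ rfl hq)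
  have hDw : Dlin (j + 5) (v - q) = 0 := by rw [map_sub, hqv, sub_self]
  have hXw := X_zero_mul_mem_Rij hw
  have h := Dlin_mem_descend (Dlin_mem_descend
    (mem_descend_zero (g := j + 5) (X_zero_mul_mem_Rij hXw)))
  rw [Dlin_X_zero_mul _ hXw, Dlin_X_zero_mul _ hw, hDw, mul_zero, zero_add ((_ : ℚ) • _), mul_smul_comm,
    ← add_smul, map_smul, Dlin_X_zero_mul _ hw, hDw, mul_zero, zero_add ((_ : ℚ) • _), smul_smul] at h
  refine (Submodule.smul_mem_iff _ ?_).mp h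
  push_cast
  ring_nf
  norm_num

theorem Rij_le_descend_one {j : ℕ} (hj : 7 ≤ j) : Rij (j + 4) j ≤ descend (j + 5) j 1 := by
  intro v hv
  obtain ⟨q, hq, hqv⟩ := exists_Dlin_eq (Rij_le_descend_two hj (Dlin_mem_Rij (j + 5) hv))
  rw [← sub_add_cancel v q]
  refine add_mem ?_ hq
  have hw : v - q ∈ Rij (j + 4) j := sub_mem hv (descend_le_Rij _ _ 1 _ rfl hq)
  have hDw : Dlin (j + 5) (v - q) = 0 := by rw [map_sub, hqv, sub_self]
  have h := Dlin_mem_descend (mem_descend_zero (g := j + 5) (X_zero_mul_mem_Rij hw))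
  rw [Dlin_X_zero_mul _ hw, hDw, mul_zero, zero_add ((_ : ℚ) • _)] at h
  refine (Submodule.smul_mem_iff _ ?_).mp h
  push_cast
  ring_nf
  norm_num

/-- if `g ≥ 12` then every element of `R` of level `g − 5` lies in `I`;
that is, `𝓡^i_{(g−5)} = 0` for all `i`. -/
theorem stmt7 (g : ℕ) (hg : 12 ≤ g) (i : ℕ) : Rij i (g - 5) ≤ Ipol g := by
  obtain ⟨j, rfl⟩ : ∃ j, g = j + 5 := ⟨g - 5, by omega⟩
  rw [Nat.add_sub_cancel]
  have hj : 7 ≤ j := by omega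
  have hI := fun n => descend_le_Ipol (j + 5) n (show 1 ≤ j by omega)
  rcases lt_or_ge (j + 5) i with h | h
  · refine le_trans (Submodule.span_mono ?_) le_sup_left
    rintro _ ⟨d, h1, -, rfl⟩
    exact ⟨d, h1 ▸ h, rfl⟩
  rcases le_or_gt i j with h' | h'
  · refine Submodule.span_le.mpr ?_
    rintro _ ⟨d, h1, h2, rfl⟩
    have hdeg := codimW_eq_levelW_add_degree d
    obtain rfl := (Finsupp.degree_eq_zero_iff d).mp (by omega)
    simp [levelW] at h2
    omega
  obtain rfl | rfl | rfl | rfl | rfl : i = j + 1 ∨ i = j + 2 ∨ i = j + 3 ∨ i = j + 4 ∨ i = j + 5 := by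
    omega
  · exact (Rij_le_descend_four hj).trans (hI 4)
  · exact (Rij_le_descend_three hj).trans (hI 3)
  · exact (Rij_le_descend_two hj).trans (hI 2)
  · exact (Rij_le_descend_one hj).trans (hI 1)
  · exact le_trans (fun p hp => mem_descend_zero hp) (hI 0)
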